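/- arXiv:1506.01055 — 7 statements merged into one kernel-verified Lean document; each statement's English description precedes it below -/
import Mathlib

section
/- Let f : {-1,1}^n → {-1,1} be computable by a parity decision tree of depth d, and let σ² = 4·Pr[f(x) = 1]·Pr[f(x) = -1] (probabilities over uniform x) be the variance of f. Then ∑_{i=1}^n f̂(i) ≤ √(4·ln 2 · σ² · d). -/
open Finset

/-- The ±1 sign value of a boolean: `true ↦ 1`, `false ↦ -1`. -/
def bsign (b : Bool) : ℝ := if b then 1 else -1

/-- The parity character `χ_S(x) = ∏_{i ∈ S} x_i` (with `x_i = ±1`), as an integer. -/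
def chi {n : ℕ} (S : Finset (Fin n)) (x : Fin n → Bool) : ℤ :=
  ∏ i ∈ S, (if x i then 1 else -1)

/-- Parity decision trees on `n` variables, with leaves labelled in `{-1,1}`
(encoded as `Bool`, `true ↦ 1`, `false ↦ -1`).  At an internal node labelled `S`,
an input `x` follows the edge labelled `χ_S(x)`: the `tpos` child if `χ_S(x) = 1`
and the `tneg` child if `χ_S(x) = -1`. -/
inductive PDT (n : ℕ) : Type where
  | leaf (b : Bool) : PDT n
  | node (S : Finset (Fin n)) (tneg tpos : PDT n) : PDT n

namespace PDT

variable {n : ℕ}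

/-- The depth of the tree: maximum number of internal nodes on a root-to-leaf path. -/
def depth : PDT n → ℕ
  | leaf _ => 0
  | node _ t0 t1 => max (depth t0) (depth t1) + 1

/-- The label of the leaf reached by input `x`. -/
def eval : PDT n → (Fin n → Bool) → Bool
  | leaf b, _ => b
  | node S t0 t1, x => if chi S x = 1 then eval t1 x else eval t0 x

/-- The identity of the leaf reached by input `x`, recorded as the sequence of
branches taken along the root-to-leaf path. -/
def leafId : PDT n → (Fin n → Bool) → List Bool
  | leaf _, _ => []
  | node S t0 t1, x =>
      if chi S x = 1 then true :: leafId t1 x else false :: leafId t0 x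

/-- Number of internal nodes on the root-to-leaf path followed by input `x`. -/
def depthOn : PDT n → (Fin n → Bool) → ℕ
  | leaf _, _ => 0
  | node S t0 t1, x =>
      (if chi S x = 1 then depthOn t1 x else depthOn t0 x) + 1

/-- `T` computes `f` if every input reaches a leaf labelled `f x`. -/
def Computes (T : PDT n) (f : (Fin n → Bool) → Bool) : Prop :=
  ∀ x, T.eval x = f x

/-- The vector `ℓ ∈ {-1,0,1}^n` associated to the leaf reached by `x`:
`ℓ i` is the average of the `i`-th coordinate (as a `±1` value) over the
uniform distribution on inputs reaching that leaf. -/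
noncomputable def leafVec (T : PDT n) (x : Fin n → Bool) (i : Fin n) : ℝ :=
  (∑ y : Fin n → Bool, if T.leafId y = T.leafId x then bsign (y i) else 0) /
    ((Finset.univ.filter fun y : Fin n → Bool => T.leafId y = T.leafId x).card)

/-- A boolean-valued function `φ` of the input is fixed by the path to the leaf
reached by `x` if it is constant on the set of inputs reaching that leaf. -/
def FixedAt (T : PDT n) (x : Fin n → Bool) (φ : (Fin n → Bool) → Bool) : Prop :=
  ∀ y z : Fin n → Bool, T.leafId y = T.leafId x → T.leafId z = T.leafId x → φ y = φ z

/-- `T` is (pairwise) correlation-free: along any root-to-leaf path, whenever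
`x_i ⊕ x_j` (for `i ≠ j`) is fixed, both `x_i` and `x_j` are fixed. -/
def CorrelationFree (T : PDT n) : Prop :=
  ∀ i j : Fin n, i ≠ j → ∀ x : Fin n → Bool,
    FixedAt T x (fun y => xor (y i) (y j)) →
    FixedAt T x (fun y => y i) ∧ FixedAt T x (fun y => y j)

/-- `T'` refines `T`: the set of inputs reaching any given leaf of `T'` is
contained in the set of inputs reaching some leaf of `T`. -/
def Refines (T' T : PDT n) : Prop :=
  ∀ y z : Fin n → Bool, T'.leafId y = T'.leafId z → T.leafId y = T.leafId z

/-- An ordinary decision tree: every internal node queries a single coordinate. -/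
def Ordinary : PDT n → Prop
  | leaf _ => True
  | node S t0 t1 => (∃ i : Fin n, S = {i}) ∧ Ordinary t0 ∧ Ordinary t1

end PDT

/-- The linear Fourier coefficient `f̂(i) = E_x[f(x)·x_i]` over uniform `x ∈ {-1,1}^n`. -/
noncomputable def fhat {n : ℕ} (f : (Fin n → Bool) → Bool) (i : Fin n) : ℝ :=
  (∑ x : Fin n → Bool, bsign (f x) * bsign (x i)) / 2 ^ n

/-- The index of coordinate `j` of the `i`-th block of `n` consecutive coordinates. -/
def blockIdx {m n : ℕ} (i : Fin m) (j : Fin n) : Fin (m * n) :=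
  ⟨i.1 * n + j.1, by
    have hj := j.isLt
    calc i.1 * n + j.1 < i.1 * n + n := by omega
      _ = (i.1 + 1) * n := by ring
      _ ≤ m * n := Nat.mul_le_mul_right n i.isLt⟩

/-- Composition `f ∘ g` on `m·n` variables, applying `g` to each of the `m` blocks
of `n` consecutive coordinates. -/
def compose {m n : ℕ} (f : (Fin m → Bool) → Bool) (g : (Fin n → Bool) → Bool)
    (x : Fin (m * n) → Bool) : Bool :=
  f fun i => g fun j => x (blockIdx i j)

/-- `MAJ₃`: returns `1` (`true`) iff `x₁ + x₂ + x₃ > 0` for `x ∈ {-1,1}³`. -/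
def maj3 (x : Fin 3 → Bool) : Bool :=
  decide (0 < (if x 0 then 1 else -1) + (if x 1 then 1 else -1) + (if x 2 then (1 : ℤ) else -1))

/-- The recursive majority function `MAJ₃^{⊗k}`, with `MAJ₃^{⊗1} = MAJ₃` and
`MAJ₃^{⊗k}` applying `MAJ₃` to `MAJ₃^{⊗(k-1)}` evaluated on the three blocks of
`3^{k-1}` consecutive coordinates. -/
def recMaj : (k : ℕ) → (Fin (3 ^ k) → Bool) → Bool
  | 0, x => x ⟨0, by norm_num⟩
  | k + 1, x => maj3 fun b =>
      recMaj k fun j => x ⟨b.1 * 3 ^ k + j.1, by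
        have hb := b.isLt
        have hj := j.isLt
        calc b.1 * 3 ^ k + j.1 < b.1 * 3 ^ k + 3 ^ k := by omega
          _ = (b.1 + 1) * 3 ^ k := by ring
          _ ≤ 3 * 3 ^ k := Nat.mul_le_mul_right (3 ^ k) hb
          _ = 3 ^ (k + 1) := by ring⟩

/-- The coordinatewise sum over `𝔽₂` of three points of the cube. -/
def xor3 {n : ℕ} (x y z : Fin n → Bool) : Fin n → Bool :=
  fun i => (x i ^^ y i) ^^ z i

/-- A set of points of the cube is affine if it is closed under sums of three points. -/
def IsAffineSet {n : ℕ} (A : Finset (Fin n → Bool)) : Prop :=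
  ∀ x ∈ A, ∀ y ∈ A, ∀ z ∈ A, xor3 x y z ∈ A

/-- A boolean function on the cube is affine if it preserves sums of three points. -/
def IsAffineFun {n : ℕ} (φ : (Fin n → Bool) → Bool) : Prop :=
  ∀ x y z, φ (xor3 x y z) = ((φ x ^^ φ y) ^^ φ z)

/-- The sum of the coordinates of a point of the cube, as `±1` values. -/
noncomputable def coordSum {n : ℕ} (x : Fin n → Bool) : ℝ := ∑ i, bsign (x i)

lemma bsign_mul_self (b : Bool) : bsign b * bsign b = 1 := by
  cases b <;> simp [bsign]

lemma bsign_mul_bsign (b c : Bool) : bsign b * bsign c = -bsign (b ^^ c) := by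
  cases b <;> cases c <;> simp [bsign]

lemma xor3_involutive {n : ℕ} (x y z : Fin n → Bool) : xor3 x y (xor3 x y z) = z := by
  funext i
  simp only [xor3]
  cases x i <;> cases y i <;> cases z i <;> rfl

lemma isAffineFun_coord {n : ℕ} (i : Fin n) : IsAffineFun fun x : Fin n → Bool => x i :=
  fun _ _ _ => rfl

lemma isAffineFun_xor {n : ℕ} (i j : Fin n) :
    IsAffineFun fun x : Fin n → Bool => x i ^^ x j := by
  intro x y z
  simp only [xor3]
  cases x i <;> cases y i <;> cases z i <;> cases x j <;> cases y j <;> cases z j <;> rfl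

lemma chi_eq_one_or {n : ℕ} (S : Finset (Fin n)) (x : Fin n → Bool) :
    chi S x = 1 ∨ chi S x = -1 := by
  unfold chi
  refine Finset.prod_induction _ (fun a : ℤ => a = 1 ∨ a = -1) ?_ (Or.inl rfl) ?_
  · rintro a b (rfl | rfl) (rfl | rfl) <;> simp
  · intro i _
    cases x i <;> simp

lemma chi_xor3 {n : ℕ} (S : Finset (Fin n)) (x y z : Fin n → Bool) :
    chi S (xor3 x y z) = chi S x * chi S y * chi S z := by
  simp only [chi, ← Finset.prod_mul_distrib]
  refine Finset.prod_congr rfl fun i _ => ?_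
  rcases hx : x i <;> rcases hy : y i <;> rcases hz : z i <;> simp [xor3, hx, hy, hz]

lemma isAffineFun_chi {n : ℕ} (S : Finset (Fin n)) :
    IsAffineFun fun x => decide (chi S x = 1) := by
  intro x y z
  simp only [chi_xor3]
  rcases chi_eq_one_or S x with h | h <;> rcases chi_eq_one_or S y with h' | h' <;>
    rcases chi_eq_one_or S z with h'' | h'' <;> simp [h, h', h'']

lemma IsAffineSet.filter {n : ℕ} {A : Finset (Fin n → Bool)} (hA : IsAffineSet A)
    {φ : (Fin n → Bool) → Bool} (hφ : IsAffineFun φ) (b : Bool) :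
    IsAffineSet (A.filter fun x => φ x = b) := by
  intro x hx y hy z hz
  rw [Finset.mem_filter] at *
  refine ⟨hA x hx.1 y hy.1 z hz.1, ?_⟩
  rw [hφ, hx.2, hy.2, hz.2]
  cases b <;> rfl

/-- An affine function which is not constant on an affine set splits it into equal halves. -/
lemma IsAffineSet.card_filter_eq {n : ℕ} {A : Finset (Fin n → Bool)} (hA : IsAffineSet A)
    {φ : (Fin n → Bool) → Bool} (hφ : IsAffineFun φ)
    (h : ¬ ∀ x ∈ A, ∀ y ∈ A, φ x = φ y) (b : Bool) :
    (A.filter fun x => φ x = b).card = (A.filter fun x => φ x = !b).card := by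
  push Not at h
  obtain ⟨x, hx, y, hy, hxy⟩ := h
  refine Finset.card_bij' (fun z _ => xor3 x y z) (fun z _ => xor3 x y z) ?_ ?_
    (fun z _ => xor3_involutive x y z) (fun z _ => xor3_involutive x y z)
  all_goals
    intro z hz
    rw [Finset.mem_filter] at *
    refine ⟨hA x hx y hy z hz.1, ?_⟩
    rw [hφ, hz.2]
    revert hxy
    cases φ x <;> cases φ y <;> simp

lemma IsAffineSet.sum_bsign_eq_zero {n : ℕ} {A : Finset (Fin n → Bool)} (hA : IsAffineSet A)
    {φ : (Fin n → Bool) → Bool} (hφ : IsAffineFun φ)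
    (h : ¬ ∀ x ∈ A, ∀ y ∈ A, φ x = φ y) : ∑ x ∈ A, bsign (φ x) = 0 := by
  have hc := hA.card_filter_eq hφ h true
  rw [← Finset.sum_filter_add_sum_filter_not A fun x => φ x = true]
  have h1 : ∑ x ∈ A with φ x = true, bsign (φ x) = (A.filter fun x => φ x = true).card := by
    rw [Finset.sum_congr rfl (g := fun _ => (1 : ℝ))
      fun x hx => by simp [bsign, (Finset.mem_filter.1 hx).2]]
    simp
  have h2 : ∑ x ∈ A with ¬ φ x = true, bsign (φ x)
      = -((A.filter fun x => φ x = false).card : ℝ) := by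
    rw [Finset.sum_congr rfl (g := fun _ => (-1 : ℝ))
      fun x hx => by simp [bsign, (Finset.mem_filter.1 hx).2]]
    simp
  rw [h1, h2, hc]
  simp

lemma IsAffineSet.card_le_two_mul_card_filter {n : ℕ} {A : Finset (Fin n → Bool)}
    (hA : IsAffineSet A) {φ : (Fin n → Bool) → Bool} (hφ : IsAffineFun φ) (b : Bool) :
    (A.filter fun x => φ x = b) = ∅ ∨ A.card ≤ 2 * (A.filter fun x => φ x = b).card := by
  by_cases h : ∀ x ∈ A, ∀ y ∈ A, φ x = φ y
  · rcases (A.filter fun x => φ x = b).eq_empty_or_nonempty with he | ⟨x, hx⟩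
    · exact Or.inl he
    · right
      rw [Finset.mem_filter] at hx
      rw [Finset.filter_true_of_mem fun y hy => (h y hy x hx.1).trans hx.2]
      omega
  · right
    have hc := hA.card_filter_eq hφ h b
    have hs := Finset.card_filter_add_card_filter_not (s := A) fun x => φ x = b
    have he : (A.filter fun x => ¬ φ x = b) = A.filter fun x => φ x = !b :=
      Finset.filter_congr fun x _ => by cases φ x <;> cases b <;> simp
    rw [he] at hs
    omega

/-- A set of points determined by their coordinates outside `D` has at most `2 ^ (n - |D|)`
elements. -/
lemma card_mul_two_pow_le {n : ℕ} (A : Finset (Fin n → Bool)) (D : Finset (Fin n))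
    (h : ∀ x ∈ A, ∀ y ∈ A, (∀ i ∉ D, x i = y i) → x = y) :
    A.card * 2 ^ D.card ≤ 2 ^ n := by
  have h1 : A.card ≤ (Finset.univ : Finset ({i // i ∉ D} → Bool)).card := by
    refine Finset.card_le_card_of_injOn (fun x i => x i.1) (fun _ _ => by simp) ?_
    intro x hx y hy hxy
    exact h x hx y hy fun i hi => congrFun hxy ⟨i, hi⟩
  have h2 : Fintype.card {i // i ∉ D} + D.card = n := by
    have := Fintype.card_subtype_compl (fun i => i ∈ D)
    have hD := Finset.card_le_univ D
    simp only [Fintype.card_fin, Fintype.card_coe] at this hD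
    omega
  calc A.card * 2 ^ D.card ≤ 2 ^ Fintype.card {i // i ∉ D} * 2 ^ D.card := by
        refine Nat.mul_le_mul_right _ (h1.trans_eq ?_)
        simp
    _ = 2 ^ n := by rw [← pow_add, h2]

/-- The coordinates having zero mean on `A` and being uncorrelated on `A` with every other
coordinate. -/
noncomputable def uncorrelated {n : ℕ} (A : Finset (Fin n → Bool)) : Finset (Fin n) :=
  Finset.univ.filter fun i => ∑ x ∈ A, bsign (x i) = 0 ∧
    ∀ j, j ≠ i → ∑ x ∈ A, bsign (x i) * bsign (x j) = 0

lemma IsAffineSet.le_card_uncorrelated {n k : ℕ} {A : Finset (Fin n → Bool)}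
    (hA : IsAffineSet A) (hk : 2 ^ n ≤ A.card * 2 ^ k) :
    n ≤ (uncorrelated A).card + 2 * k := by
  classical
  let C : Fin n → Prop := fun i => ∀ x ∈ A, ∀ y ∈ A, x i = y i
  let P : Fin n → Fin n → Prop := fun i j => ∀ x ∈ A, ∀ y ∈ A, (x i ^^ x j) = (y i ^^ y j)
  have hP_symm : ∀ i j, P i j → P j i := fun i j h x hx y hy => by
    rw [Bool.xor_comm (x j), Bool.xor_comm (y j)]
    exact h x hx y hy
  have hP_trans : ∀ i j l, P i j → P j l → P i l := fun i j l h h' x hx y hy => by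
    have h1 := h x hx y hy
    have h2 := h' x hx y hy
    revert h1 h2
    cases x i <;> cases y i <;> cases x j <;> cases y j <;> cases x l <;> cases y l <;> simp
  let D : Finset (Fin n) := Finset.univ.filter fun i => C i ∨ ∃ j < i, P i j
  have hmem : ∀ i, i ∈ D ↔ C i ∨ ∃ j < i, P i j := fun i => by simp [D]
  have hD : D.card ≤ k := by
    have hdet := card_mul_two_pow_le A D (by
      intro x hx y hy hxy
      funext i
      induction i using WellFoundedLT.induction with
      | ind i ih =>
        by_cases hi : i ∈ D
        · rcases (hmem i).1 hi with h | ⟨j, hj, h⟩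
          · exact h x hx y hy
          · have h1 := h x hx y hy
            rw [ih j hj] at h1
            exact Bool.xor_left_inj.1 h1
        · exact hxy i hi)
    have hpos : 0 < A.card := by
      rcases Nat.eq_zero_or_pos A.card with h0 | h0
      · rw [h0] at hk
        have : 0 < 2 ^ n := by positivity
        omega
      · exact h0
    exact (Nat.pow_le_pow_iff_right (by norm_num : 1 < 2)).1
      (Nat.le_of_mul_le_mul_left (hdet.trans hk) hpos)
  have hpartner : ∀ i, i ∉ uncorrelated A → i ∉ D → ∃ j ∈ D, P i j := by
    intro i hi hiD
    rw [hmem] at hiD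
    push Not at hiD
    simp only [uncorrelated, Finset.mem_filter, Finset.mem_univ, true_and, not_and] at hi
    have h1 := hi (hA.sum_bsign_eq_zero (isAffineFun_coord i) hiD.1)
    push Not at h1
    obtain ⟨j, hji, hj⟩ := h1
    have hPij : P i j := by
      by_contra hc
      refine hj ?_
      simp only [bsign_mul_bsign, Finset.sum_neg_distrib]
      rw [hA.sum_bsign_eq_zero (isAffineFun_xor i j) hc, neg_zero]
    have hlt : i < j := by
      rcases lt_trichotomy i j with h | h | h
      · exact h
      · exact absurd h.symm hji
      · exact absurd hPij (hiD.2 j h)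
    exact ⟨j, (hmem j).2 (Or.inr ⟨i, hlt, hP_symm _ _ hPij⟩), hPij⟩
  choose! g hgD hgP using hpartner
  have hcard : ((uncorrelated A)ᶜ \ D).card ≤ D.card := by
    refine Finset.card_le_card_of_injOn g ?_ ?_
    · intro i hi
      simp only [Finset.coe_sdiff, Finset.coe_compl, Set.mem_sdiff, Set.mem_compl_iff,
        Finset.mem_coe] at hi
      exact hgD i hi.1 hi.2
    · intro i hi j hj hij
      simp only [Finset.coe_sdiff, Finset.coe_compl, Set.mem_sdiff, Set.mem_compl_iff,
        Finset.mem_coe] at hi hj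
      have hPij : P i j := by
        refine hP_trans _ _ _ (hgP i hi.1 hi.2) ?_
        rw [hij]
        exact hP_symm _ _ (hgP j hj.1 hj.2)
      rcases lt_trichotomy i j with h | h | h
      · exact absurd ((hmem j).2 (Or.inr ⟨i, h, hP_symm _ _ hPij⟩)) hj.2
      · exact h
      · exact absurd ((hmem i).2 (Or.inr ⟨j, h, hPij⟩)) hi.2
  have h1 : ((uncorrelated A)ᶜ).card ≤ ((uncorrelated A)ᶜ \ D).card + D.card := by
    rw [Finset.card_sdiff_add_card]
    exact Finset.card_le_card Finset.subset_union_left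
  have h2 := Finset.card_add_card_compl (uncorrelated A)
  rw [Fintype.card_fin] at h2
  omega

lemma sum_coordSum_mul_uncorrelated {n : ℕ} (A : Finset (Fin n → Bool)) (B : Finset (Fin n))
    (hB : uncorrelated A ⊆ B) :
    ∑ x ∈ A, (∑ j ∈ B, bsign (x j)) * ∑ i ∈ uncorrelated A, bsign (x i)
      = A.card * (uncorrelated A).card := by
  simp only [Finset.sum_mul_sum]
  rw [Finset.sum_comm, Finset.sum_congr rfl fun j _ => Finset.sum_comm, Finset.sum_comm]
  have key : ∀ i ∈ uncorrelated A, ∑ j ∈ B, ∑ x ∈ A, bsign (x j) * bsign (x i) = A.card := by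
    intro i hi
    rw [Finset.sum_eq_single_of_mem i (hB hi)]
    · simp [bsign_mul_self]
    · intro j _ hji
      have := (Finset.mem_filter.1 hi).2.2 j hji
      simpa only [mul_comm] using this
  rw [Finset.sum_congr rfl key, Finset.sum_const, nsmul_eq_mul, mul_comm]

/-- On an affine set of codimension at most `k`, the sum of the coordinates has variance at least
`n - 2 * k`. -/
lemma IsAffineSet.sq_sum_coordSum_le {n k : ℕ} {A : Finset (Fin n → Bool)}
    (hA : IsAffineSet A) (hk : 2 ^ n ≤ A.card * 2 ^ k) :
    (∑ x ∈ A, coordSum x) ^ 2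
      ≤ A.card * (∑ x ∈ A, coordSum x ^ 2 - A.card * ((n : ℝ) - 2 * k)) := by
  let W : (Fin n → Bool) → ℝ := fun x => ∑ i ∈ uncorrelated A, bsign (x i)
  have hW : ∑ x ∈ A, W x = 0 := by
    rw [Finset.sum_comm]
    exact Finset.sum_eq_zero fun i hi => (Finset.mem_filter.1 hi).2.1
  have hWW : ∑ x ∈ A, W x * W x = A.card * (uncorrelated A).card :=
    sum_coordSum_mul_uncorrelated A _ subset_rfl
  have hXW : ∑ x ∈ A, coordSum x * W x = A.card * (uncorrelated A).card :=
    sum_coordSum_mul_uncorrelated A _ (Finset.subset_univ _)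
  have hn : (n : ℝ) ≤ (uncorrelated A).card + 2 * k := by
    exact_mod_cast hA.le_card_uncorrelated hk
  have hcs := sq_sum_le_card_mul_sum_sq (s := A) (f := fun x => coordSum x - W x)
  have hsq : ∑ x ∈ A, (coordSum x - W x) ^ 2
      = ∑ x ∈ A, coordSum x ^ 2 - A.card * (uncorrelated A).card := by
    have : ∀ x, (coordSum x - W x) ^ 2
        = coordSum x ^ 2 - 2 * (coordSum x * W x) + W x * W x := fun x => by ring
    simp only [this, Finset.sum_add_distrib, Finset.sum_sub_distrib, ← Finset.mul_sum, hWW, hXW]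
    ring
  rw [Finset.sum_sub_distrib, hW, sub_zero, hsq] at hcs
  refine hcs.trans ?_
  have hc : (0 : ℝ) ≤ A.card := Nat.cast_nonneg _
  refine mul_le_mul_of_nonneg_left (sub_le_sub_left (mul_le_mul_of_nonneg_left ?_ hc) _) hc
  linarith

/-- The function `Z` is the conditional expectation of the sum of the coordinates given the leaf
of `T` that is reached, within an affine set `A`. -/
lemma PDT.exists_conditional_coordSum {n d : ℕ} (T : PDT n) :
    ∀ (A : Finset (Fin n → Bool)) (k : ℕ), IsAffineSet A →
      (A = ∅ ∨ 2 ^ n ≤ A.card * 2 ^ k) → k + T.depth ≤ d →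
      ∃ Z : (Fin n → Bool) → ℝ,
        (∀ g : Bool → ℝ, ∑ x ∈ A, g (T.eval x) * coordSum x = ∑ x ∈ A, g (T.eval x) * Z x) ∧
        ∑ x ∈ A, Z x ^ 2 ≤ ∑ x ∈ A, (coordSum x ^ 2 - ((n : ℝ) - 2 * d)) := by
  induction T with
  | leaf b =>
    intro A k hA hk hd
    rcases hk with rfl | hk
    · exact ⟨0, by simp⟩
    have hpos : (0 : ℝ) < A.card := by
      rcases Nat.eq_zero_or_pos A.card with h0 | h0
      · rw [h0] at hk
        have : 0 < 2 ^ n := by positivity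
        omega
      · exact_mod_cast h0
    refine ⟨fun _ => (∑ x ∈ A, coordSum x) / A.card, fun g => ?_, ?_⟩
    · simp only [PDT.eval, ← Finset.mul_sum, Finset.sum_const, nsmul_eq_mul]
      field_simp
    · have hmain := hA.sq_sum_coordSum_le hk
      have hkd : (k : ℝ) ≤ d := by
        exact_mod_cast (Nat.le_add_right _ _).trans hd
      rw [Finset.sum_const, Finset.sum_sub_distrib, Finset.sum_const, nsmul_eq_mul, nsmul_eq_mul]
      have hdiv : (A.card : ℝ) * ((∑ x ∈ A, coordSum x) / A.card) ^ 2
          = (∑ x ∈ A, coordSum x) ^ 2 / A.card := by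
        field_simp
      rw [hdiv, div_le_iff₀' hpos]
      refine hmain.trans (mul_le_mul_of_nonneg_left (sub_le_sub_left ?_ _) hpos.le)
      exact mul_le_mul_of_nonneg_left (by linarith) hpos.le
  | node S t0 t1 ih0 ih1 =>
    intro A k hA hk hd
    have hφ := isAffineFun_chi S
    have hsize : ∀ b, (A.filter fun x => decide (chi S x = 1) = b) = ∅ ∨
        2 ^ n ≤ (A.filter fun x => decide (chi S x = 1) = b).card * 2 ^ (k + 1) := by
      intro b
      rcases hk with rfl | hk
      · simp
      refine (hA.card_le_two_mul_card_filter hφ b).imp_right fun h => ?_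
      calc 2 ^ n ≤ A.card * 2 ^ k := hk
        _ ≤ _ := Nat.mul_le_mul_right _ h
        _ = _ := by ring
    simp only [PDT.depth] at hd
    obtain ⟨Z0, hg0, hZ0⟩ := ih0 _ (k + 1) (hA.filter hφ false) (hsize false) (by omega)
    obtain ⟨Z1, hg1, hZ1⟩ := ih1 _ (k + 1) (hA.filter hφ true) (hsize true) (by omega)
    simp only [decide_eq_true_eq, decide_eq_false_iff_not] at hg0 hZ0 hg1 hZ1
    refine ⟨fun x => if chi S x = 1 then Z1 x else Z0 x, fun g => ?_, ?_⟩
    · rw [← Finset.sum_filter_add_sum_filter_not A fun x => chi S x = 1,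
        ← Finset.sum_filter_add_sum_filter_not A fun x => chi S x = 1]
      refine congrArg₂ _ ?_ ?_
      · refine Eq.trans (Finset.sum_congr rfl fun x hx => ?_)
          ((hg1 g).trans (Finset.sum_congr rfl fun x hx => ?_)) <;>
        simp [PDT.eval, (Finset.mem_filter.1 hx).2]
      · refine Eq.trans (Finset.sum_congr rfl fun x hx => ?_)
          ((hg0 g).trans (Finset.sum_congr rfl fun x hx => ?_)) <;>
        simp [PDT.eval, (Finset.mem_filter.1 hx).2]
    · rw [← Finset.sum_filter_add_sum_filter_not A fun x => chi S x = 1,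
        ← Finset.sum_filter_add_sum_filter_not A fun x => chi S x = 1]
      refine add_le_add ?_ ?_
      · refine (Finset.sum_congr rfl fun x hx => ?_).trans_le hZ1
        simp [(Finset.mem_filter.1 hx).2]
      · refine (Finset.sum_congr rfl fun x hx => ?_).trans_le hZ0
        simp [(Finset.mem_filter.1 hx).2]

lemma uncorrelated_univ {n : ℕ} :
    uncorrelated (Finset.univ : Finset (Fin n → Bool)) = Finset.univ := by
  refine Finset.eq_univ_of_card _ (le_antisymm (Finset.card_le_univ _) ?_)
  have h : IsAffineSet (Finset.univ : Finset (Fin n → Bool)) := fun _ _ _ _ _ _ => by simp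
  simpa using h.le_card_uncorrelated (k := 0) (by simp)

lemma sum_coordSum {n : ℕ} : ∑ x : Fin n → Bool, coordSum x = 0 := by
  unfold coordSum
  rw [Finset.sum_comm]
  refine Finset.sum_eq_zero fun i _ => ?_
  have hi : i ∈ uncorrelated (Finset.univ : Finset (Fin n → Bool)) := by
    rw [uncorrelated_univ]
    exact Finset.mem_univ i
  exact (Finset.mem_filter.1 hi).2.1

lemma sum_coordSum_sq {n : ℕ} : ∑ x : Fin n → Bool, coordSum x ^ 2 = 2 ^ n * n := by
  have h := sum_coordSum_mul_uncorrelated (Finset.univ : Finset (Fin n → Bool)) Finset.univ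
    (Finset.subset_univ _)
  simpa [uncorrelated_univ, ← sq, coordSum] using h

/-- The inequality with the constant `2` in place of `4 * log 2`. -/
lemma sq_sum_fhat_le {n d : ℕ} (f : (Fin n → Bool) → Bool) (T : PDT n)
    (hT : T.Computes f) (hd : T.depth ≤ d) :
    (∑ i : Fin n, fhat f i) ^ 2
      ≤ 2 * (4 * (((Finset.univ.filter fun x : Fin n → Bool => f x = true).card : ℝ) / 2 ^ n)
        * (((Finset.univ.filter fun x : Fin n → Bool => f x = false).card : ℝ) / 2 ^ n)) * d := by
  obtain ⟨Z, hZ, hZ2⟩ := T.exists_conditional_coordSum (d := d) Finset.univ 0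
    (fun _ _ _ _ _ _ => Finset.mem_univ _) (Or.inr (by simp)) (by omega)
  rw [Finset.sum_sub_distrib, sum_coordSum_sq] at hZ2
  have hZ2' : ∑ x, Z x ^ 2 ≤ 2 ^ n * (2 * d) := by
    simp only [Finset.sum_const, Finset.card_univ, Fintype.card_pi, Fintype.card_bool,
      Finset.prod_const, Fintype.card_fin, nsmul_eq_mul] at hZ2
    push_cast at hZ2
    linarith
  set p : ℝ := ((Finset.univ.filter fun x : Fin n → Bool => f x = true).card : ℝ) / 2 ^ n with hp
  set q : ℝ := ((Finset.univ.filter fun x : Fin n → Bool => f x = false).card : ℝ) / 2 ^ n with hq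
  have hN : (0 : ℝ) < 2 ^ n := by positivity
  have hsum : ∀ g : Bool → ℝ, ∑ x, g (f x) = 2 ^ n * (p * g true + q * g false) := by
    intro g
    have h1 : ∀ x, g (f x)
        = (if f x = true then g true else 0) + if f x = false then g false else 0 := by
      intro x
      cases f x <;> simp
    simp only [h1, Finset.sum_add_distrib, ← Finset.sum_filter, Finset.sum_const, nsmul_eq_mul]
    rw [hp, hq]
    field_simp
  have hpq : p + q = 1 := by
    have h1 := hsum fun _ => 1
    simp only [Finset.sum_const, Finset.card_univ, Fintype.card_pi, Fintype.card_bool,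
      Finset.prod_const, Fintype.card_fin, nsmul_eq_mul, mul_one] at h1
    push_cast at h1
    exact (mul_left_cancel₀ hN.ne' (by linarith)).symm
  have hfZ : ∑ i, fhat f i = (∑ x, (bsign (f x) - (p - q)) * Z x) / 2 ^ n := by
    have h1 := hZ fun b => bsign b - (p - q)
    simp only [hT _] at h1
    rw [← h1]
    simp only [sub_mul, Finset.sum_sub_distrib, ← Finset.mul_sum, sum_coordSum]
    simp only [fhat, ← Finset.sum_div, coordSum, Finset.mul_sum]
    rw [Finset.sum_comm]
    simp
  have hvar : ∑ x, (bsign (f x) - (p - q)) ^ 2 = 2 ^ n * (4 * p * q) := by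
    rw [hsum fun b => (bsign b - (p - q)) ^ 2]
    have : q = 1 - p := by linarith
    simp only [bsign, this]
    simp
    ring
  have hcs := Finset.sum_mul_sq_le_sq_mul_sq Finset.univ (fun x => bsign (f x) - (p - q)) Z
  rw [hvar] at hcs
  rw [hfZ, div_pow, div_le_iff₀ (by positivity)]
  have hp0 : 0 ≤ p := by positivity
  have hq0 : 0 ≤ q := by positivity
  calc _ ≤ _ := hcs
    _ ≤ 2 ^ n * (4 * p * q) * (2 ^ n * (2 * d)) := by gcongr
    _ = _ := by ring

/-- **Theorem (O'Donnell–Servedio inequality for parity decision trees).**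
If `f : {-1,1}ⁿ → {-1,1}` is computable by a parity decision tree of depth `d`
and `σ² = 4·Pr[f(x)=1]·Pr[f(x)=-1]`, then `∑ᵢ f̂(i) ≤ √(4·ln 2·σ²·d)`. -/
theorem pdt_OS_inequality {n d : ℕ} (f : (Fin n → Bool) → Bool) (T : PDT n)
    (hT : T.Computes f) (hd : T.depth ≤ d) (σ2 : ℝ)
    (hσ : σ2 = 4 * (((Finset.univ.filter fun x : Fin n → Bool => f x = true).card : ℝ) / 2 ^ n)
      * (((Finset.univ.filter fun x : Fin n → Bool => f x = false).card : ℝ) / 2 ^ n)) :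
    ∑ i : Fin n, fhat f i ≤ Real.sqrt (4 * Real.log 2 * σ2 * d) := by
  refine Real.le_sqrt_of_sq_le ((sq_sum_fhat_le f T hT hd).trans ?_)
  rw [← hσ]
  have hσ0 : 0 ≤ σ2 := by
    rw [hσ]
    positivity
  have hlog : 2 ≤ 4 * Real.log 2 := by linarith [Real.log_two_gt_d9]
  gcongr
end

section
/- Let T be a parity decision tree on n variables of depth d. Then there exists a refinement T' of T which is a correlation-free parity decision tree of depth at most 2d. -/
open Finset

namespace PDT

variable {n : ℕ}

theorem chi_eq_one_or_neg_one (S : Finset (Fin n)) (x : Fin n → Bool) :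
    chi S x = 1 ∨ chi S x = -1 := by
  unfold chi
  induction S using Finset.induction_on with
  | empty => simp
  | insert a S ha ih =>
    rw [Finset.prod_insert ha]
    rcases ih with h | h <;> rw [h] <;> cases x a <;> simp

/-- The pointwise product of two inputs, under the encoding `true ↦ 1`, `false ↦ -1`. -/
def inputMul (x y : Fin n → Bool) : Fin n → Bool := fun i => x i == y i

theorem chi_inputMul (S : Finset (Fin n)) (x y : Fin n → Bool) :
    chi S (inputMul x y) = chi S x * chi S y := by
  unfold chi
  rw [← Finset.prod_mul_distrib]
  refine Finset.prod_congr rfl fun i _ => ?_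
  cases hx : x i <;> cases hy : y i <;> simp [inputMul, hx, hy]

theorem inputMul_inputMul_cancel (x y : Fin n → Bool) : inputMul x (inputMul x y) = y := by
  funext i
  cases hx : x i <;> cases hy : y i <;> simp [inputMul, hx, hy]

theorem chi_singleton_eq_one_iff (i : Fin n) (x : Fin n → Bool) :
    chi {i} x = 1 ↔ x i = true := by
  cases h : x i <;> simp [chi, h]

/-- The inputs on which all the parities in `L` equal `1`. -/
def parityKernel (L : Finset (Finset (Fin n))) : Finset (Fin n → Bool) :=
  univ.filter fun y => ∀ S ∈ L, chi S y = 1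

theorem mem_parityKernel {L : Finset (Finset (Fin n))} {y : Fin n → Bool} :
    y ∈ parityKernel L ↔ ∀ S ∈ L, chi S y = 1 := by
  simp [parityKernel]

theorem inputMul_mem_parityKernel {L : Finset (Finset (Fin n))} {x y : Fin n → Bool} :
    inputMul x y ∈ parityKernel L ↔ ∀ S ∈ L, chi S y = chi S x := by
  rw [mem_parityKernel]
  refine forall₂_congr fun S _ => ?_
  rw [chi_inputMul]
  rcases chi_eq_one_or_neg_one S x with h | h <;>
    rcases chi_eq_one_or_neg_one S y with h' | h' <;> simp [h, h']

/-- The coordinates determined by the parities in `L`. -/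
def fixedCoords (L : Finset (Finset (Fin n))) : Finset (Fin n) :=
  univ.filter fun i => ∀ y ∈ parityKernel L, y i = true

theorem mem_fixedCoords {L : Finset (Finset (Fin n))} {i : Fin n} :
    i ∈ fixedCoords L ↔ ∀ y ∈ parityKernel L, y i = true := by
  simp [fixedCoords]

theorem mem_parityKernel_insert {L : Finset (Finset (Fin n))} {S : Finset (Fin n)}
    {y : Fin n → Bool} :
    y ∈ parityKernel (insert S L) ↔ chi S y = 1 ∧ y ∈ parityKernel L := by
  simp [mem_parityKernel]

theorem card_parityKernel_le_insert (S : Finset (Fin n)) (L : Finset (Finset (Fin n))) :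
    (parityKernel L).card ≤ 2 * (parityKernel (insert S L)).card := by
  classical
  have hsub : (parityKernel L).filter (fun y => chi S y = 1) = parityKernel (insert S L) := by
    ext y
    simp [mem_parityKernel_insert, and_comm]
  have hcard := Finset.card_filter_add_card_filter_not (s := parityKernel L)
    (fun y => chi S y = 1)
  suffices h : ((parityKernel L).filter (fun y => ¬ chi S y = 1)).card ≤
      (parityKernel (insert S L)).card by
    rw [hsub] at hcard
    omega
  rcases ((parityKernel L).filter (fun y => ¬ chi S y = 1)).eq_empty_or_nonempty with h | ⟨z, hz⟩
  · simp [h]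
  · have hval : ∀ y, ¬ chi S y = 1 → chi S y = -1 := fun y hy =>
      (chi_eq_one_or_neg_one S y).resolve_left hy
    rw [Finset.mem_filter] at hz
    refine Finset.card_le_card_of_injOn (inputMul z) (fun y hy => ?_) (fun y _ y' _ h => ?_)
    · rw [Finset.mem_coe, Finset.mem_filter] at hy
      rw [Finset.mem_coe, mem_parityKernel_insert, chi_inputMul, hval z hz.2, hval y hy.2,
        inputMul_mem_parityKernel]
      refine ⟨by norm_num, fun R hR => ?_⟩
      rw [mem_parityKernel.1 hy.1 R hR, mem_parityKernel.1 hz.1 R hR]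
    · rw [← inputMul_inputMul_cancel z y, h, inputMul_inputMul_cancel]

theorem two_pow_le_card_parityKernel (L : Finset (Finset (Fin n))) :
    2 ^ n ≤ 2 ^ L.card * (parityKernel L).card := by
  classical
  induction L using Finset.induction_on with
  | empty => simp [parityKernel]
  | insert S L hS ih =>
    rw [Finset.card_insert_of_notMem hS, pow_succ, mul_assoc]
    exact ih.trans (Nat.mul_le_mul_left _ (card_parityKernel_le_insert S L))

theorem card_mul_two_pow_card_le {K : Finset (Fin n → Bool)} {F : Finset (Fin n)}
    (h : ∀ y ∈ K, ∀ i ∈ F, y i = true) : K.card * 2 ^ F.card ≤ 2 ^ n := by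
  classical
  have hK : K ⊆ Fintype.piFinset fun i => if i ∈ F then {true} else univ := by
    intro y hy
    rw [Fintype.mem_piFinset]
    intro i
    by_cases hi : i ∈ F
    · simp [hi, h y hy i hi]
    · simp [hi]
  have hcard : (Fintype.piFinset fun i : Fin n =>
      if i ∈ F then ({true} : Finset Bool) else univ).card = 2 ^ (n - F.card) := by
    rw [Fintype.card_piFinset]
    have : ∀ i : Fin n, (if i ∈ F then ({true} : Finset Bool) else univ).card =
        if i ∈ F then 1 else 2 := fun i => by split_ifs <;> simp
    simp only [this, Finset.prod_ite, Finset.prod_const_one, one_mul, Finset.prod_const]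
    congr 1
    rw [Finset.filter_not, Finset.card_sdiff]
    simp
  have hF : F.card ≤ n := by simpa using F.card_le_univ
  calc K.card * 2 ^ F.card ≤ 2 ^ (n - F.card) * 2 ^ F.card :=
        Nat.mul_le_mul_right _ (hcard ▸ Finset.card_le_card hK)
    _ = 2 ^ n := by rw [← pow_add, Nat.sub_add_cancel hF]

theorem card_fixedCoords_le (L : Finset (Finset (Fin n))) : (fixedCoords L).card ≤ L.card := by
  have h₁ := two_pow_le_card_parityKernel L
  have h₂ : (parityKernel L).card * 2 ^ (fixedCoords L).card ≤ 2 ^ n :=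
    card_mul_two_pow_card_le fun y hy i hi => mem_fixedCoords.1 hi y hy
  have hpos : 0 < (parityKernel L).card :=
    Nat.pos_of_ne_zero fun h => by simp [h] at h₁
  refine (Nat.pow_le_pow_iff_right (a := 2) (by norm_num)).1 ?_
  refine Nat.le_of_mul_le_mul_left ?_ hpos
  rw [mul_comm _ (2 ^ L.card)]
  exact h₂.trans h₁

/-- Whenever the parities in `L` determine `x_i ⊕ x_j` with `i ≠ j`, they determine both
`x_i` and `x_j`. -/
def Uncorrelated (L : Finset (Finset (Fin n))) : Prop :=
  ∀ i j : Fin n, i ≠ j → (∀ y ∈ parityKernel L, y i = y j) →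
    i ∈ fixedCoords L ∧ j ∈ fixedCoords L

/-- The labels of the internal nodes visited by the input `x`. -/
def queries : PDT n → (Fin n → Bool) → Finset (Finset (Fin n))
  | leaf _, _ => ∅
  | node S t0 t1, x => insert S (if chi S x = 1 then queries t1 x else queries t0 x)

theorem leafId_eq_iff (T : PDT n) (x y : Fin n → Bool) :
    T.leafId y = T.leafId x ↔ ∀ S ∈ T.queries x, chi S y = chi S x := by
  induction T with
  | leaf b => simp [leafId, queries]
  | node S t0 t1 ih0 ih1 =>
    rcases chi_eq_one_or_neg_one S x with hx | hx <;>
      rcases chi_eq_one_or_neg_one S y with hy | hy <;>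
      simp [leafId, queries, hx, hy, ih0, ih1]

theorem card_fixedCoords_insert {L : Finset (Finset (Fin n))} {i j : Fin n} (hij : i ≠ j)
    (hL : ∀ y ∈ parityKernel L, y i = y j) (hnot : ¬ (i ∈ fixedCoords L ∧ j ∈ fixedCoords L)) :
    (fixedCoords L).card + 2 ≤ (fixedCoords (insert {i} L)).card := by
  have hiff : i ∈ fixedCoords L ↔ j ∈ fixedCoords L := by
    simp only [mem_fixedCoords]
    exact forall₂_congr fun y hy => by rw [hL y hy]
  have hi : i ∉ fixedCoords L := fun h => hnot ⟨h, hiff.1 h⟩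
  have hj : j ∉ fixedCoords L := fun h => hnot ⟨hiff.2 h, h⟩
  have hsub : insert i (insert j (fixedCoords L)) ⊆ fixedCoords (insert {i} L) := by
    intro k hk
    rw [mem_fixedCoords]
    intro y hy
    rw [mem_parityKernel_insert, chi_singleton_eq_one_iff] at hy
    rw [Finset.mem_insert, Finset.mem_insert] at hk
    rcases hk with rfl | rfl | hk
    · exact hy.1
    · rw [← hL y hy.2]
      exact hy.1
    · exact mem_fixedCoords.1 hk y hy.2
  have hcard := Finset.card_le_card hsub
  rwa [Finset.card_insert_of_notMem (by simp [hij, hi]), Finset.card_insert_of_notMem hj]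
    at hcard

theorem exists_uncorrelated_extension (k : ℕ) (L : Finset (Finset (Fin n)))
    (hk : L.card ≤ (fixedCoords L).card + k) :
    ∃ t : PDT n, t.depth ≤ k ∧ ∀ x, Uncorrelated (t.queries x ∪ L) := by
  induction k generalizing L with
  | zero =>
    refine ⟨leaf true, le_rfl, fun x => ?_⟩
    rw [queries, Finset.empty_union]
    intro i j hij hL
    by_contra hnot
    have h₁ := card_fixedCoords_insert hij hL hnot
    have h₂ := card_fixedCoords_le (insert {i} L)
    have h₃ := Finset.card_insert_le {i} L
    omega
  | succ k ih =>
    by_cases hU : Uncorrelated L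
    · exact ⟨leaf true, Nat.zero_le _, fun x => by rwa [queries, Finset.empty_union]⟩
    · unfold Uncorrelated at hU
      push Not at hU
      obtain ⟨i, j, hij, hL, hnot⟩ := hU
      have h₁ := card_fixedCoords_insert hij hL fun h => hnot h.1 h.2
      have h₃ := Finset.card_insert_le {i} L
      obtain ⟨t, ht, htU⟩ := ih (insert {i} L) (by omega)
      refine ⟨node {i} t t, by simpa [depth] using ht, fun x => ?_⟩
      have := htU x
      rwa [queries, ite_self, Finset.insert_union, ← Finset.union_insert]

theorem exists_refines_uncorrelated (T : PDT n) (L : Finset (Finset (Fin n))) :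
    ∃ T' : PDT n, T'.Refines T ∧ T'.depth ≤ 2 * T.depth + L.card ∧
      ∀ x, Uncorrelated (T'.queries x ∪ L) := by
  induction T generalizing L with
  | leaf b =>
    obtain ⟨t, ht, htU⟩ := exists_uncorrelated_extension L.card L (Nat.le_add_left _ _)
    exact ⟨t, fun _ _ _ => rfl, by simpa [depth] using ht, htU⟩
  | node S t0 t1 ih0 ih1 =>
    obtain ⟨t0', hr0, hd0, hU0⟩ := ih0 (insert S L)
    obtain ⟨t1', hr1, hd1, hU1⟩ := ih1 (insert S L)
    refine ⟨node S t0' t1', fun y z h => ?_, ?_, fun x => ?_⟩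
    · unfold leafId at h ⊢
      split_ifs at h ⊢ <;> simp only [List.cons.injEq, true_and, reduceCtorEq, false_and] at h ⊢
      · exact hr1 y z h
      · exact hr0 y z h
    · have := Finset.card_insert_le S L
      simp only [depth]
      omega
    · rw [queries, Finset.insert_union, ← Finset.union_insert]
      split_ifs
      · exact hU1 x
      · exact hU0 x

theorem correlationFree_of_uncorrelated {T : PDT n} (h : ∀ x, Uncorrelated (T.queries x)) :
    T.CorrelationFree := by
  intro i j hij x hx
  have hmem : ∀ y, T.leafId y = T.leafId x ↔ inputMul x y ∈ parityKernel (T.queries x) :=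
    fun y => by rw [leafId_eq_iff, inputMul_mem_parityKernel]
  have hfix : ∀ k ∈ fixedCoords (T.queries x), FixedAt T x fun y => y k := by
    intro k hk y z hy hz
    have hy' := mem_fixedCoords.1 hk _ ((hmem y).1 hy)
    have hz' := mem_fixedCoords.1 hk _ ((hmem z).1 hz)
    simp only [inputMul, beq_iff_eq] at hy' hz'
    exact hy'.symm.trans hz'
  obtain ⟨hi, hj⟩ := h x i j hij fun y hy => by
    have hxy := hx (inputMul x y) x
      ((hmem _).2 (by rwa [inputMul_inputMul_cancel])) rfl
    revert hxy
    simp only [inputMul]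
    cases x i <;> cases x j <;> cases y i <;> cases y j <;> simp
  exact ⟨hfix i hi, hfix j hj⟩

end PDT

/-- **Proposition.** Every parity decision tree of depth `d` has a refinement which is
a correlation-free parity decision tree of depth at most `2d`. -/
theorem exists_correlationFree_refinement {n d : ℕ} (T : PDT n) (hd : T.depth ≤ d) :
    ∃ T' : PDT n, T'.Refines T ∧ T'.CorrelationFree ∧ T'.depth ≤ 2 * d := by
  obtain ⟨T', hr, hT', hU⟩ := PDT.exists_refines_uncorrelated T ∅
  refine ⟨T', hr, PDT.correlationFree_of_uncorrelated fun x => ?_, ?_⟩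
  · simpa using hU x
  · rw [Finset.card_empty] at hT'
    omega
end

section
/- Let T' be any refinement of a parity decision tree T on n variables. Then E_{ℓ∈T}[(∑_{i=1}^n ℓ_i)²] ≤ E_{ℓ'∈T'}[(∑_{i=1}^n ℓ'_i)²], where in each tree the leaves carry the distribution induced by a uniform random input. -/
open Finset

/-- The average of `g` over the fiber of `F` containing `x`. -/
noncomputable def fiberAvg {α β : Type*} [Fintype α] [DecidableEq β]
    (F : α → β) (g : α → ℝ) (x : α) : ℝ :=
  (∑ y, if F y = F x then g y else 0) / (Finset.univ.filter fun y => F y = F x).card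

theorem fiberAvg_congr {α β : Type*} [Fintype α] [DecidableEq β]
    (F : α → β) (g : α → ℝ) {x y : α} (h : F x = F y) : fiberAvg F g x = fiberAvg F g y := by
  simp only [fiberAvg, h]

/-- Averaging over fibers is self-adjoint against functions that are constant on fibers. -/
theorem sum_fiberAvg_mul {α β : Type*} [Fintype α] [DecidableEq β]
    (F : α → β) (g c : α → ℝ) (hc : ∀ x y, F x = F y → c x = c y) :
    ∑ x, fiberAvg F g x * c x = ∑ x, g x * c x := by
  simp only [fiberAvg, Finset.sum_div, Finset.sum_mul]
  rw [Finset.sum_comm]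
  refine Finset.sum_congr rfl fun y _ => ?_
  set N := Finset.univ.filter fun z => F z = F y with hN
  have hpos : (N.card : ℝ) ≠ 0 := by
    exact_mod_cast (Finset.card_pos.mpr ⟨y, by simp [hN]⟩).ne'
  calc _ = ∑ x, if F x = F y then g y * c y / N.card else 0 := by
        refine Finset.sum_congr rfl fun x _ => ?_
        by_cases hxy : F x = F y
        · rw [if_pos hxy, if_pos hxy.symm, hc x y hxy, hxy]
          ring
        · rw [if_neg hxy, if_neg (Ne.symm hxy)]
          simp
    _ = g y * c y := by
        rw [← Finset.sum_filter, Finset.sum_const, nsmul_eq_mul, mul_div_cancel₀ _ hpos]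

/-- Refining the partition into fibers can only increase the second moment of the averages. -/
theorem sum_sq_fiberAvg_le {α β γ : Type*} [Fintype α] [DecidableEq β] [DecidableEq γ]
    (F : α → β) (F' : α → γ) (h : ∀ x y, F' x = F' y → F x = F y) (g : α → ℝ) :
    ∑ x, fiberAvg F g x ^ 2 ≤ ∑ x, fiberAvg F' g x ^ 2 := by
  have hF := sum_fiberAvg_mul F g (fiberAvg F g) fun _ _ => fiberAvg_congr F g
  have hF' := sum_fiberAvg_mul F' g (fiberAvg F g) fun x y hxy => fiberAvg_congr F g (h x y hxy)
  have hsq : 0 ≤ ∑ x, (fiberAvg F' g x - fiberAvg F g x) ^ 2 :=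
    Finset.sum_nonneg fun _ _ => sq_nonneg _
  simp only [sub_sq, Finset.sum_add_distrib, Finset.sum_sub_distrib, mul_assoc,
    ← Finset.mul_sum] at hsq
  simp only [← sq] at hF
  linarith

theorem PDT.sum_leafVec {n : ℕ} (T : PDT n) (x : Fin n → Bool) :
    ∑ i, T.leafVec x i = fiberAvg T.leafId (fun y => ∑ i, bsign (y i)) x := by
  simp only [PDT.leafVec, fiberAvg, ← Finset.sum_div]
  rw [Finset.sum_comm]
  congr 1
  refine Finset.sum_congr rfl fun y _ => ?_
  split_ifs <;> simp

/-- **Proposition.** Refining a parity decision tree can only increase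
`E_{ℓ∈T}[(∑ᵢ ℓᵢ)²]` (leaves distributed according to the fraction of uniform
inputs reaching them). -/
theorem refinement_leaf_second_moment_mono {n : ℕ} (T T' : PDT n) (h : T'.Refines T) :
    (∑ x : Fin n → Bool, (∑ i : Fin n, T.leafVec x i) ^ 2) / 2 ^ n ≤
      (∑ x : Fin n → Bool, (∑ i : Fin n, T'.leafVec x i) ^ 2) / 2 ^ n := by
  simp only [PDT.sum_leafVec]
  gcongr ?_ / _
  exact sum_sq_fiberAvg_le _ _ h _
end

section
/- Let f : {-1,1}^n → {-1,1} be computable by a parity decision tree T. Then ∑_{i=1}^n f̂(i) ≤ E_{ℓ∈T}[|∑_{i=1}^n ℓ_i|], where ℓ ranges over the leaves of T with the distribution induced by a uniform random input. -/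
open Finset

/-- Averaging a function over the fibers of `k` preserves its sum against any weight that is
constant on these fibers. -/
theorem sum_mul_fiber_average {X K : Type*} [Fintype X] [DecidableEq K] (k : X → K) (g h : X → ℝ)
    (hg : ∀ x y, k x = k y → g x = g y) :
    ∑ x, g x * ((∑ y, if k y = k x then h y else 0) / #{y | k y = k x}) = ∑ x, g x * h x := by
  have fiber_sum (y : X) :
      ∑ x, (if k y = k x then g x * h y / #{z | k z = k x} else 0) = g y * h y := by
    have hcard : (#{z | k z = k y} : ℝ) ≠ 0 :=
      Nat.cast_ne_zero.mpr (card_ne_zero_of_mem (mem_filter.mpr ⟨mem_univ y, rfl⟩))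
    calc
      _ = ∑ x, if k x = k y then g y * h y / #{z | k z = k y} else 0 := by
        refine sum_congr rfl fun x _ => ?_
        by_cases hxy : k x = k y
        · simp [hxy, hg x y hxy]
        · simp [hxy, Ne.symm hxy]
      _ = g y * h y := by
        rw [← sum_filter, sum_const, nsmul_eq_mul, mul_div_cancel₀ _ hcard]
  rw [← sum_congr rfl fun y _ => fiber_sum y, sum_comm]
  refine sum_congr rfl fun x _ => ?_
  rw [sum_div, mul_sum]
  refine sum_congr rfl fun y _ => ?_
  split_ifs <;> ring

/-- Inputs reaching the same leaf receive the same label. -/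
theorem PDT.eval_eq_of_leafId_eq {n : ℕ} (T : PDT n) {x y : Fin n → Bool}
    (h : T.leafId x = T.leafId y) : T.eval x = T.eval y := by
  induction T with
  | leaf b => rfl
  | node S t0 t1 ih0 ih1 =>
    simp only [PDT.leafId] at h
    simp only [PDT.eval]
    split_ifs at h ⊢ <;> simp_all

theorem abs_bsign (b : Bool) : |bsign b| = 1 := by
  cases b <;> simp [bsign]

/-- **Lemma (O'Donnell–Servedio).** If `f` is computable by a parity decision tree `T`,
then `∑ᵢ f̂(i) ≤ E_{ℓ∈T}[|∑ᵢ ℓᵢ|]`, where the leaf `ℓ` is distributed according to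
the fraction of uniform inputs reaching it. -/
theorem fhat_sum_le_leaf_abs_exp {n : ℕ} (f : (Fin n → Bool) → Bool) (T : PDT n)
    (hT : T.Computes f) :
    ∑ i : Fin n, fhat f i ≤ (∑ x : Fin n → Bool, |∑ i : Fin n, T.leafVec x i|) / 2 ^ n := by
  have fhat_eq (i : Fin n) :
      fhat f i = (∑ x, bsign (f x) * T.leafVec x i) / 2 ^ n := by
    unfold fhat PDT.leafVec
    rw [sum_mul_fiber_average T.leafId (fun x => bsign (f x)) (fun y => bsign (y i))]
    intro x y hxy
    rw [← hT x, ← hT y, T.eval_eq_of_leafId_eq hxy]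
  simp_rw [fhat_eq]
  rw [← sum_div, sum_comm]
  gcongr with x
  rw [← mul_sum]
  exact (le_abs_self _).trans_eq (by rw [abs_mul, abs_bsign, one_mul])
end

section
/- Let f : {-1,1}^n → {-1,1} be computable by a parity decision tree of depth d. Then ∑_{i=1}^n f̂(i) ≤ √(2d). -/
open Finset

/-- The character of `{-1,1}ⁿ` attached to `u ∈ 𝔽₂ⁿ`, as a real-valued function. -/
noncomputable def character {n : ℕ} (u : Fin n → ZMod 2) (x : Fin n → Bool) : ℝ :=
  ∏ i, if u i = 0 then 1 else bsign (x i)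

lemma character_add {n : ℕ} (u v : Fin n → ZMod 2) (x : Fin n → Bool) :
    character (u + v) x = character u x * character v x := by
  unfold character
  rw [← Finset.prod_mul_distrib]
  refine Finset.prod_congr rfl fun i _ => ?_
  have h : ∀ a b : ZMod 2, (a + b = 0 ↔ (a = 0 ↔ b = 0)) := by decide
  rw [Pi.add_apply]
  by_cases hu : u i = 0 <;> by_cases hv : v i = 0 <;> simp [h, hu, hv, bsign_mul_self]

lemma character_single {n : ℕ} (i : Fin n) (x : Fin n → Bool) :
    character (Pi.single i 1) x = bsign (x i) := by
  unfold character
  rw [Finset.prod_eq_single i]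
  · simp
  · intro j _ hj
    simp [hj]
  · simp

lemma sum_character_eq_zero {n : ℕ} {u : Fin n → ZMod 2} (hu : u ≠ 0) :
    ∑ x : Fin n → Bool, character u x = 0 := by
  obtain ⟨i, hi⟩ := Function.ne_iff.mp hu
  have h := Finset.prod_univ_sum (fun _ : Fin n => (Finset.univ : Finset Bool))
    (fun i b => if u i = 0 then (1 : ℝ) else bsign b)
  rw [Fintype.piFinset_univ] at h
  unfold character
  rw [← h]
  refine Finset.prod_eq_zero (Finset.mem_univ i) ?_
  have hi' : u i ≠ 0 := hi
  simp [hi', bsign]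

/-- The indicator vector in `𝔽₂ⁿ` of a set of coordinates. -/
def indicatorVec {n : ℕ} (S : Finset (Fin n)) (i : Fin n) : ZMod 2 := if i ∈ S then 1 else 0

lemma character_indicatorVec {n : ℕ} (S : Finset (Fin n)) (x : Fin n → Bool) :
    character (indicatorVec S) x = if chi S x = 1 then 1 else -1 := by
  have hcast : character (indicatorVec S) x = (chi S x : ℝ) := by
    unfold character chi
    push_cast
    rw [← Finset.prod_filter_mul_prod_filter_not Finset.univ (· ∈ S)]
    rw [Finset.prod_congr rfl (g := fun i => bsign (x i)), Finset.prod_congr rfl (g := fun _ => 1)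
      (s₁ := Finset.univ.filter fun i => ¬ i ∈ S)]
    · simp [bsign]
    · intro i hi
      simp_all [indicatorVec]
    · intro i hi
      simp_all [indicatorVec]
  have hsign : chi S x = 1 ∨ chi S x = -1 := by
    unfold chi
    refine Finset.prod_induction _ (fun a : ℤ => a = 1 ∨ a = -1) ?_ (Or.inl rfl) ?_
    · rintro a b (rfl | rfl) (rfl | rfl) <;> simp
    · intro i _
      cases x i <;> simp
  rw [hcast]
  rcases hsign with h | h <;> simp [h]

namespace PDT

variable {n : ℕ}

/-- The span of `V` and of the queries made by the tree on input `x`. -/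
def querySpan : PDT n → Submodule (ZMod 2) (Fin n → ZMod 2) → (Fin n → Bool) →
    Submodule (ZMod 2) (Fin n → ZMod 2)
  | leaf _, V, _ => V
  | node S t0 t1, V, x =>
      if chi S x = 1 then querySpan t1 (V ⊔ Submodule.span _ {indicatorVec S}) x
      else querySpan t0 (V ⊔ Submodule.span _ {indicatorVec S}) x

lemma finrank_querySpan_le (T : PDT n) (V : Submodule (ZMod 2) (Fin n → ZMod 2))
    (x : Fin n → Bool) :
    Module.finrank (ZMod 2) (T.querySpan V x) ≤ Module.finrank (ZMod 2) V + T.depth := by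
  induction T generalizing V with
  | leaf b => exact le_rfl
  | node S t0 t1 ih0 ih1 =>
    have hsup : Module.finrank (ZMod 2) ↥(V ⊔ Submodule.span (ZMod 2) {indicatorVec S}) ≤
        Module.finrank (ZMod 2) V + 1 :=
      (Submodule.finrank_add_le_finrank_add_finrank _ _).trans
        (Nat.add_le_add_left ((finrank_span_le_card _).trans (by simp)) _)
    have h0 := ih0 (V ⊔ Submodule.span (ZMod 2) {indicatorVec S})
    have h1 := ih1 (V ⊔ Submodule.span (ZMod 2) {indicatorVec S})
    rw [depth, querySpan]
    by_cases h : chi S x = 1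
    · rw [if_pos h]
      omega
    · rw [if_neg h]
      omega

/-- A function of the leaf reached and of its query span is orthogonal to the character of `u`
as soon as it vanishes on the leaves whose query span contains `u`. -/
lemma sum_character_mul_eq_zero (T : PDT n) (V : Submodule (ZMod 2) (Fin n → ZMod 2))
    (w : (Fin n → Bool) → ℝ) (hw : ∀ u ∉ V, ∑ x, w x * character u x = 0)
    (G : Submodule (ZMod 2) (Fin n → ZMod 2) → Bool → ℝ) (u : Fin n → ZMod 2)
    (hG : ∀ W b, u ∈ W → G W b = 0) :
    ∑ x, w x * character u x * G (T.querySpan V x) (T.eval x) = 0 := by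
  induction T generalizing V w with
  | leaf b =>
    simp only [querySpan, eval]
    rw [← Finset.sum_mul]
    by_cases hu : u ∈ V
    · rw [hG V b hu, mul_zero]
    · rw [hw u hu, zero_mul]
  | node S t0 t1 ih0 ih1 =>
    set s := indicatorVec S with hs
    have hsplit : ∀ c : ℝ, ∀ v ∉ V ⊔ Submodule.span (ZMod 2) {s},
        ∑ x, (w x * (1 + c * character s x) / 2) * character v x = 0 := by
      intro c v hv
      have hsV : s ∈ V ⊔ Submodule.span (ZMod 2) {s} :=
        Submodule.mem_sup_right (Submodule.mem_span_singleton_self s)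
      have h1 := hw v fun h => hv (Submodule.mem_sup_left h)
      have h2 := hw (v + s) fun h =>
        hv ((Submodule.add_mem_iff_left _ hsV).mp (Submodule.mem_sup_left h))
      calc _ = (∑ x, w x * character v x) / 2 + c * (∑ x, w x * character (v + s) x) / 2 := by
            rw [Finset.mul_sum, Finset.sum_div, Finset.sum_div, ← Finset.sum_add_distrib]
            refine Finset.sum_congr rfl fun x _ => ?_
            rw [character_add]
            ring
        _ = 0 := by rw [h1, h2]; simp
    have h1 := ih1 _ _ (hsplit 1)
    have h0 := ih0 _ _ (hsplit (-1))
    rw [← add_zero (0 : ℝ)]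
    nth_rewrite 1 [← h1]
    rw [← h0, ← Finset.sum_add_distrib]
    refine Finset.sum_congr rfl fun x _ => ?_
    rw [hs, character_indicatorVec]
    simp only [querySpan, eval]
    split_ifs <;> ring

lemma sum_character_mul_querySpan_bot_eq_zero (T : PDT n)
    (G : Submodule (ZMod 2) (Fin n → ZMod 2) → Bool → ℝ) (u : Fin n → ZMod 2)
    (hG : ∀ W b, u ∈ W → G W b = 0) :
    ∑ x, character u x * G (T.querySpan ⊥ x) (T.eval x) = 0 := by
  have h := T.sum_character_mul_eq_zero ⊥ (fun _ => 1) (fun v hv => by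
    simpa using sum_character_eq_zero (by simpa using hv)) G u hG
  simpa using h

end PDT

open Classical in
/-- The coordinates `i` for which `x_i`, or some `x_i x_j` with `j ≠ i`, has its vector in `V`. -/
noncomputable def correlatedCoords {n : ℕ} (V : Submodule (ZMod 2) (Fin n → ZMod 2)) :
    Finset (Fin n) :=
  Finset.univ.filter fun i => Pi.single i 1 ∈ V ∨ ∃ j ≠ i, Pi.single i 1 + Pi.single j 1 ∈ V

open Classical in
lemma card_correlatedCoords_le {n : ℕ} (V : Submodule (ZMod 2) (Fin n → ZMod 2)) :
    (correlatedCoords V).card ≤ 2 * Module.finrank (ZMod 2) V := by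
  let g : Fin n → (Fin n → ZMod 2) ⧸ V := fun i => V.mkQ (Pi.single i 1)
  let I := (Finset.univ.image g).erase 0
  have hspan : Submodule.span (ZMod 2) (I : Set ((Fin n → ZMod 2) ⧸ V)) = ⊤ := by
    have hI : (I : Set ((Fin n → ZMod 2) ⧸ V)) = Set.range g \ {0} := by
      simp [I, Finset.coe_erase]
    have hrange : Set.range g = V.mkQ '' Set.range (Pi.basisFun (ZMod 2) (Fin n)) := by
      rw [← Set.range_comp]
      congr 1
      ext i
      simp [g]
    rw [hI, Submodule.span_sdiff_singleton_zero, hrange, Submodule.span_image, Module.Basis.span_eq,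
      Submodule.map_top, Submodule.range_mkQ]
  have hquot : Module.finrank (ZMod 2) ((Fin n → ZMod 2) ⧸ V) ≤ I.card := by
    have h := finrank_span_finset_le_card (R := ZMod 2) I
    rwa [Set.finrank, hspan, finrank_top] at h
  have hdim := Submodule.finrank_quotient_add_finrank V
  rw [Module.finrank_fin_fun] at hdim
  have hself : ∀ j, g j + g j = 0 := by
    intro j
    have h : (Pi.single j 1 + Pi.single j 1 : Fin n → ZMod 2) = 0 := by
      ext k
      exact CharTwo.add_self_eq_zero _
    simp only [g, ← map_add, h, map_zero]
  have hmaps : ∀ s : Finset (Fin n),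
      ∑ y ∈ I, (s.filter fun i => g i = y).card ≤ s.card := by
    intro s
    refine le_trans (le_of_eq ?_) (Finset.card_filter_le s (g · ∈ I))
    convert Finset.sum_card_fiberwise_eq_card_filter s I g
  have hfiber : ∀ y ∈ I, 2 ≤ (Finset.univ.filter fun i => g i = y).card +
      ((correlatedCoords V)ᶜ.filter fun i => g i = y).card := by
    intro y hy
    obtain ⟨hy0, hy1⟩ := Finset.mem_erase.mp hy
    obtain ⟨i, -, rfl⟩ := Finset.mem_image.mp hy1
    by_cases hi : i ∈ correlatedCoords V
    · have hi' : Pi.single i 1 ∈ V ∨ ∃ j ≠ i, Pi.single i 1 + Pi.single j 1 ∈ V := by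
        simpa [correlatedCoords] using hi
      rcases hi' with h | ⟨j, hj, h⟩
      · exact absurd ((Submodule.Quotient.mk_eq_zero V).mpr h) hy0
      · have hij : g i + g j = 0 := by
          rw [← map_add]
          exact (Submodule.Quotient.mk_eq_zero V).mpr h
        have hgj : g j = g i := add_left_cancel ((hself j).trans ((add_comm _ _).trans hij).symm)
        have : 1 < (Finset.univ.filter fun k => g k = g i).card :=
          Finset.one_lt_card.mpr ⟨i, by simp, j, by simp [hgj], hj.symm⟩
        omega
    · have h1 : 0 < (Finset.univ.filter fun k => g k = g i).card :=
        Finset.card_pos.mpr ⟨i, by simp⟩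
      have h2 : 0 < ((correlatedCoords V)ᶜ.filter fun k => g k = g i).card :=
        Finset.card_pos.mpr ⟨i, by simp [hi]⟩
      omega
  have hsum := Finset.sum_le_sum hfiber
  rw [Finset.sum_const, Finset.sum_add_distrib, smul_eq_mul] at hsum
  have h1 := hmaps Finset.univ
  have h2 := hmaps (correlatedCoords V)ᶜ
  have h3 := Finset.card_add_card_compl (correlatedCoords V)
  rw [Fintype.card_fin] at h3
  rw [Finset.card_univ, Fintype.card_fin] at h1
  omega

namespace PDT

variable {n : ℕ}

open Classical in
/-- The sum of the coordinates of `x` that are correlated at the leaf reached by `x`. -/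
noncomputable def correlatedSum (T : PDT n) (x : Fin n → Bool) : ℝ :=
  ∑ i, if i ∈ correlatedCoords (T.querySpan ⊥ x) then bsign (x i) else 0

lemma sum_eval_mul_sum_bsign (T : PDT n) :
    ∑ x, bsign (T.eval x) * ∑ i, bsign (x i) = ∑ x, bsign (T.eval x) * T.correlatedSum x := by
  classical
  rw [← sub_eq_zero, ← Finset.sum_sub_distrib]
  simp_rw [correlatedSum, ← mul_sub, ← Finset.sum_sub_distrib, Finset.mul_sum]
  rw [Finset.sum_comm]
  refine Finset.sum_eq_zero fun i _ => ?_
  refine Eq.trans ?_ (T.sum_character_mul_querySpan_bot_eq_zero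
    (fun W b => if i ∈ correlatedCoords W then 0 else bsign b) (Pi.single i 1)
    (fun W b h => if_pos (by simp [correlatedCoords, h])))
  refine Finset.sum_congr rfl fun x _ => ?_
  rw [character_single]
  split_ifs <;> ring

lemma sum_correlatedSum_sq (T : PDT n) :
    ∑ x, T.correlatedSum x ^ 2 = ∑ x, ((correlatedCoords (T.querySpan ⊥ x)).card : ℝ) := by
  classical
  have hoff : ∀ i j : Fin n, i ≠ j →
      ∑ x, (if i ∈ correlatedCoords (T.querySpan ⊥ x) then bsign (x i) else 0) *
        (if j ∈ correlatedCoords (T.querySpan ⊥ x) then bsign (x j) else 0) = 0 := by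
    intro i j hij
    have hne : (Pi.single i 1 + Pi.single j 1 : Fin n → ZMod 2) ≠ 0 := by
      intro h
      simpa [hij] using congrFun h i
    have h := T.sum_character_mul_querySpan_bot_eq_zero
      (fun W _ => if i ∈ correlatedCoords W ∧ j ∈ correlatedCoords W then 0 else 1)
      (Pi.single i 1 + Pi.single j 1) (fun W _ h => if_pos (by
        simp only [correlatedCoords, Finset.mem_filter, Finset.mem_univ, true_and]
        exact ⟨Or.inr ⟨j, hij.symm, h⟩, Or.inr ⟨i, hij, by rwa [add_comm]⟩⟩))
    refine Eq.trans ?_ ((congrArg₂ (· - ·) (sum_character_eq_zero hne) h).trans (sub_zero 0))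
    rw [← Finset.sum_sub_distrib]
    refine Finset.sum_congr rfl fun x _ => ?_
    rw [character_add, character_single, character_single]
    by_cases hi : i ∈ correlatedCoords (T.querySpan ⊥ x) <;>
      by_cases hj : j ∈ correlatedCoords (T.querySpan ⊥ x) <;> simp [hi, hj]
  simp_rw [correlatedSum, sq, Finset.sum_mul_sum]
  rw [Finset.sum_comm]
  calc _ = ∑ i, ∑ x, if i ∈ correlatedCoords (T.querySpan ⊥ x) then (1 : ℝ) else 0 := by
        refine Finset.sum_congr rfl fun i _ => ?_
        rw [Finset.sum_comm, Finset.sum_eq_single i]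
        · refine Finset.sum_congr rfl fun x _ => ?_
          split_ifs <;> simp [bsign_mul_self]
        · exact fun j _ hj => hoff i j hj.symm
        · simp
    _ = _ := by
        rw [Finset.sum_comm]
        simp

end PDT

/-- **Theorem.** If `f : {-1,1}ⁿ → {-1,1}` is computable by a parity decision tree of
depth `d`, then `∑ᵢ f̂(i) ≤ √(2d)`. -/
theorem fhat_sum_le_sqrt_two_depth {n d : ℕ} (f : (Fin n → Bool) → Bool) (T : PDT n)
    (hT : T.Computes f) (hd : T.depth ≤ d) :
    ∑ i : Fin n, fhat f i ≤ Real.sqrt (2 * d) := by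
  have hfhat : ∑ i : Fin n, fhat f i =
      (∑ x, bsign (T.eval x) * T.correlatedSum x) / 2 ^ n := by
    rw [← T.sum_eval_mul_sum_bsign]
    simp_rw [fhat, ← hT _, Finset.mul_sum]
    rw [← Finset.sum_div, Finset.sum_comm]
  have hsq : ∑ x, T.correlatedSum x ^ 2 ≤ 2 ^ n * (2 * d : ℝ) := by
    rw [T.sum_correlatedSum_sq]
    refine (Finset.sum_le_card_nsmul _ _ (2 * d : ℝ) fun x _ => ?_).trans_eq (by simp)
    have h1 := card_correlatedCoords_le (T.querySpan ⊥ x)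
    have h2 := T.finrank_querySpan_le ⊥ x
    rw [finrank_bot] at h2
    exact_mod_cast (by omega : (correlatedCoords (T.querySpan ⊥ x)).card ≤ 2 * d)
  have hcs := Finset.sum_mul_sq_le_sq_mul_sq Finset.univ
    (fun x => bsign (T.eval x)) T.correlatedSum
  have hone : ∑ x : Fin n → Bool, bsign (T.eval x) ^ 2 = 2 ^ n := by
    simp [sq, bsign_mul_self]
  rw [hone] at hcs
  have hpos : (0 : ℝ) < 2 ^ n := by positivity
  refine Real.le_sqrt_of_sq_le ?_
  rw [hfhat, div_pow, div_le_iff₀ (by positivity)]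
  calc _ ≤ (2 : ℝ) ^ n * ∑ x, T.correlatedSum x ^ 2 := hcs
    _ ≤ 2 ^ n * (2 ^ n * (2 * d)) := by gcongr
    _ = 2 * d * (2 ^ n) ^ 2 := by ring
end

section
/- Let V be a subspace of F₂^n of dimension d, and let J ⊆ {1,…,n} be the union of the supports of all vectors in V of Hamming weight at most 2 (i.e., J is the set of coordinates i such that some v ∈ V with at most two nonzero coordinates has v_i = 1). Then |J| ≤ 2d. -/
/-- Over any coordinate where a vector of `span b` is nonzero, some vector of `b` is nonzero. -/
theorem exists_mem_apply_ne_zero_of_mem_span {K ι : Type*} [Semiring K] {b : Set (ι → K)}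
    {v : ι → K} (hv : v ∈ Submodule.span K b) {i : ι} (hi : v i ≠ 0) : ∃ w ∈ b, w i ≠ 0 := by
  by_contra! h
  have hle : Submodule.span K b ≤ LinearMap.ker (LinearMap.proj (R := K) (φ := fun _ ↦ K) i) :=
    Submodule.span_le.2 fun w hw ↦ h w hw
  exact hi (hle hv)

/-- **Proposition.** Let `V` be a `d`-dimensional subspace of `F₂ⁿ` and let `J` be the
set of coordinates `i` such that some vector `v ∈ V` of Hamming weight at most `2`
has `v i = 1`. Then `|J| ≤ 2d`. -/
theorem low_weight_support_card_le {n d : ℕ}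
    (V : Submodule (ZMod 2) (Fin n → ZMod 2))
    (hd : Module.finrank (ZMod 2) V = d) :
    {i : Fin n | ∃ v ∈ V, {j : Fin n | v j ≠ 0}.ncard ≤ 2 ∧ v i = 1}.ncard ≤ 2 * d := by
  obtain ⟨b, hbS, hspan, hli⟩ :=
    exists_linearIndependent (ZMod 2) {v | v ∈ V ∧ {j : Fin n | v j ≠ 0}.ncard ≤ 2}
  classical
  have : Fintype b := Fintype.ofFinite b
  have hb : b.toFinset.card ≤ d := by
    rw [← finrank_span_set_eq_card hli, ← hd]
    exact Submodule.finrank_mono (Submodule.span_le.2 fun v hv ↦ (hbS hv).1)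
  have hcover : {i : Fin n | ∃ v ∈ V, {j : Fin n | v j ≠ 0}.ncard ≤ 2 ∧ v i = 1} ⊆
      ⋃ w ∈ b.toFinset, {j : Fin n | w j ≠ 0} := by
    rintro i ⟨v, hv, hw, hi⟩
    have hmem : v ∈ Submodule.span (ZMod 2) b := hspan ▸ Submodule.subset_span ⟨hv, hw⟩
    obtain ⟨w, hwb, hwi⟩ := exists_mem_apply_ne_zero_of_mem_span hmem (i := i) (by simp [hi])
    exact Set.mem_biUnion (Set.mem_toFinset.2 hwb) hwi
  calc _ ≤ (⋃ w ∈ b.toFinset, {j : Fin n | w j ≠ 0}).ncard :=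
        Set.ncard_le_ncard hcover (Set.toFinite _)
    _ ≤ ∑ w ∈ b.toFinset, {j : Fin n | w j ≠ 0}.ncard := Finset.set_ncard_biUnion_le _ _
    _ ≤ b.toFinset.card * 2 :=
        Finset.sum_le_card_nsmul _ _ _ fun w hw ↦ (hbS (Set.mem_toFinset.1 hw)).2
    _ ≤ 2 * d := by lia
end

section
/- Let T be an ordinary decision tree on n variables of depth d (a parity decision tree in which every internal node queries a single coordinate, i.e., is labelled by a singleton set). Then E_{ℓ∈T}[(∑_{i=1}^n ℓ_i)²] ≤ d, where ℓ ranges over the leaves of T with the distribution induced by a uniform random input. -/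
open Finset

theorem chi_singleton_eq_one_iff {n : ℕ} (i : Fin n) (x : Fin n → Bool) :
    chi {i} x = 1 ↔ x i = true := by
  cases h : x i <;> simp [chi, h]

theorem bsign_not (b : Bool) : bsign (!b) = -bsign b := by
  cases b <;> simp [bsign]

theorem bsign_sq (b : Bool) : bsign b ^ 2 = 1 := by
  cases b <;> simp [bsign]

/-- The input `x` with its `i`-th coordinate negated. -/
def flipAt {n : ℕ} (i : Fin n) (x : Fin n → Bool) : Fin n → Bool :=
  Function.update x i (!x i)

@[simp]
theorem flipAt_same {n : ℕ} (i : Fin n) (x : Fin n → Bool) : flipAt i x i = !x i := by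
  simp [flipAt]

theorem flipAt_of_ne {n : ℕ} {i j : Fin n} (h : j ≠ i) (x : Fin n → Bool) :
    flipAt i x j = x j := by
  simp [flipAt, h]

theorem flipAt_involutive {n : ℕ} (i : Fin n) : Function.Involutive (flipAt i) := by
  intro x
  simp [flipAt]

theorem sum_eq_zero_of_flipAt {n : ℕ} (i : Fin n) (f : (Fin n → Bool) → ℝ)
    (h : ∀ x, f (flipAt i x) = -f x) : ∑ x, f x = 0 := by
  have hsum := Equiv.sum_comp (flipAt_involutive i).toPerm f
  simp only [Function.Involutive.coe_toPerm, h, Finset.sum_neg_distrib] at hsum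
  linarith

namespace PDT

/-- The union of the labels of the internal nodes on the path followed by `x`. -/
def queried {n : ℕ} : PDT n → (Fin n → Bool) → Finset (Fin n)
  | leaf _, _ => ∅
  | node S t0 t1, x => S ∪ if chi S x = 1 then queried t1 x else queried t0 x

variable {n : ℕ}

theorem queried_eq_of_leafId_eq (T : PDT n) {x y : Fin n → Bool}
    (h : T.leafId y = T.leafId x) : T.queried y = T.queried x := by
  induction T with
  | leaf b => rfl
  | node S t0 t1 ih0 ih1 =>
    simp only [leafId] at h
    simp only [queried]
    split_ifs at h ⊢ <;> simp_all

theorem Ordinary.apply_eq_of_leafId_eq {T : PDT n} (hT : T.Ordinary) {x y : Fin n → Bool}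
    (h : T.leafId y = T.leafId x) {i : Fin n} (hi : i ∈ T.queried x) : y i = x i := by
  induction T with
  | leaf b => simp [queried] at hi
  | node S t0 t1 ih0 ih1 =>
    obtain ⟨⟨j, rfl⟩, h0, h1⟩ := hT
    simp only [leafId, chi_singleton_eq_one_iff] at h
    simp only [queried, chi_singleton_eq_one_iff, mem_union, mem_singleton] at hi
    rcases hi with rfl | hi
    · split_ifs at h <;> simp_all
    · split_ifs at h hi <;> simp_all

theorem Ordinary.leafId_flipAt {T : PDT n} (hT : T.Ordinary) {x : Fin n → Bool} {i : Fin n}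
    (hi : i ∉ T.queried x) : T.leafId (flipAt i x) = T.leafId x := by
  induction T with
  | leaf b => rfl
  | node S t0 t1 ih0 ih1 =>
    obtain ⟨⟨j, rfl⟩, h0, h1⟩ := hT
    simp only [queried, chi_singleton_eq_one_iff, mem_union, mem_singleton, not_or] at hi
    simp only [leafId, chi_singleton_eq_one_iff, flipAt_of_ne (Ne.symm hi.1)]
    obtain ⟨-, hi⟩ := hi
    split_ifs at hi ⊢ <;> simp_all

theorem Ordinary.leafVec_eq {T : PDT n} (hT : T.Ordinary) (x : Fin n → Bool) (i : Fin n) :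
    T.leafVec x i = if i ∈ T.queried x then bsign (x i) else 0 := by
  unfold leafVec
  split_ifs with hi
  · have hsum : (∑ y : Fin n → Bool, if T.leafId y = T.leafId x then bsign (y i) else 0) =
        (Finset.univ.filter fun y : Fin n → Bool => T.leafId y = T.leafId x).card *
          bsign (x i) := by
      rw [← Finset.sum_filter, ← nsmul_eq_mul]
      refine Finset.sum_eq_card_nsmul fun y hy => ?_
      rw [hT.apply_eq_of_leafId_eq (Finset.mem_filter.1 hy).2 hi]
    have hcard : ((Finset.univ.filter fun y : Fin n → Bool =>
        T.leafId y = T.leafId x).card : ℝ) ≠ 0 := by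
      rw [Nat.cast_ne_zero, Finset.card_ne_zero]
      exact ⟨x, by simp⟩
    rw [hsum, mul_div_cancel_left₀ _ hcard]
  · rw [sum_eq_zero_of_flipAt i, zero_div]
    intro y
    have hiff : T.leafId (flipAt i y) = T.leafId x ↔ T.leafId y = T.leafId x := by
      constructor
      · intro h
        have hy := hT.leafId_flipAt (x := flipAt i y) (i := i)
          (by rwa [T.queried_eq_of_leafId_eq h])
        rw [flipAt_involutive i y] at hy
        rw [hy, h]
      · intro h
        rw [hT.leafId_flipAt (by rwa [T.queried_eq_of_leafId_eq h]), h]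
    simp only [hiff, flipAt_same, bsign_not]
    split_ifs <;> simp

/-- Querying one more coordinate increases the weighted second moment by at most the total
weight, for weights depending only on the coordinates already queried. -/
theorem sum_mul_sq_insert_le (A : Finset (Fin n)) (i : Fin n) (g : (Fin n → Bool) → ℝ)
    (hg : ∀ x, 0 ≤ g x) (hA : ∀ j ∉ A, ∀ x, g (flipAt j x) = g x) :
    ∑ x, g x * (∑ j ∈ insert i A, bsign (x j)) ^ 2 ≤
      ∑ x, g x * ((∑ j ∈ A, bsign (x j)) ^ 2 + 1) := by
  by_cases hi : i ∈ A
  · rw [Finset.insert_eq_of_mem hi]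
    gcongr with x
    · exact hg x
    · linarith
  · have hzero : ∑ x, g x * (bsign (x i) * ∑ j ∈ A, bsign (x j)) = 0 := by
      refine sum_eq_zero_of_flipAt i _ fun x => ?_
      have hs : ∑ j ∈ A, bsign (flipAt i x j) = ∑ j ∈ A, bsign (x j) :=
        Finset.sum_congr rfl fun j hj => by
          rw [flipAt_of_ne (ne_of_mem_of_not_mem hj hi)]
      rw [hs, hA i hi, flipAt_same, bsign_not]
      ring
    refine le_of_eq ?_
    calc ∑ x, g x * (∑ j ∈ insert i A, bsign (x j)) ^ 2
        = ∑ x, (g x * ((∑ j ∈ A, bsign (x j)) ^ 2 + 1) +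
            2 * (g x * (bsign (x i) * ∑ j ∈ A, bsign (x j)))) := by
          refine Finset.sum_congr rfl fun x _ => ?_
          rw [Finset.sum_insert hi]
          linear_combination g x * bsign_sq (x i)
      _ = _ := by rw [Finset.sum_add_distrib, ← Finset.mul_sum, hzero, mul_zero, add_zero]

theorem Ordinary.sum_mul_sq_union_queried_le {T : PDT n} (hT : T.Ordinary)
    (A : Finset (Fin n)) (g : (Fin n → Bool) → ℝ)
    (hg : ∀ x, 0 ≤ g x) (hA : ∀ j ∉ A, ∀ x, g (flipAt j x) = g x) :
    ∑ x, g x * (∑ j ∈ A ∪ T.queried x, bsign (x j)) ^ 2 ≤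
      ∑ x, g x * ((∑ j ∈ A, bsign (x j)) ^ 2 + T.depth) := by
  induction T generalizing A g with
  | leaf b => simp [queried, depth]
  | node S t0 t1 ih0 ih1 =>
    obtain ⟨⟨i, rfl⟩, h0, h1⟩ := hT
    have hrestrict (b : Bool) : ∀ j ∉ insert i A, ∀ x,
        (if flipAt j x i = b then g (flipAt j x) else 0) = if x i = b then g x else 0 := by
      intro j hj x
      rw [Finset.mem_insert, not_or] at hj
      rw [flipAt_of_ne (Ne.symm hj.1), hA j hj.2]
    have hnonneg (b : Bool) (x : Fin n → Bool) : 0 ≤ if x i = b then g x else 0 := by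
      split_ifs
      exacts [hg x, le_rfl]
    have hneg := ih0 h0 (insert i A) _ (hnonneg false) (hrestrict false)
    have hpos := ih1 h1 (insert i A) _ (hnonneg true) (hrestrict true)
    calc ∑ x, g x * (∑ j ∈ A ∪ (node {i} t0 t1).queried x, bsign (x j)) ^ 2
        = ∑ x, (if x i = false then g x else 0) *
              (∑ j ∈ insert i A ∪ t0.queried x, bsign (x j)) ^ 2 +
            ∑ x, (if x i = true then g x else 0) *
              (∑ j ∈ insert i A ∪ t1.queried x, bsign (x j)) ^ 2 := by
          rw [← Finset.sum_add_distrib]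
          refine Finset.sum_congr rfl fun x _ => ?_
          have hunion (B : Finset (Fin n)) : A ∪ ({i} ∪ B) = insert i A ∪ B := by
            ext; simp
          simp only [queried, chi_singleton_eq_one_iff, hunion]
          cases x i <;> simp
      _ ≤ _ := add_le_add hneg hpos
      _ = ∑ x, g x * ((∑ j ∈ insert i A, bsign (x j)) ^ 2 +
            (if x i = true then t1.depth else t0.depth : ℕ)) := by
          rw [← Finset.sum_add_distrib]
          refine Finset.sum_congr rfl fun x _ => ?_
          cases x i <;> simp
      _ ≤ ∑ x, g x * ((∑ j ∈ insert i A, bsign (x j)) ^ 2 + (max t0.depth t1.depth : ℕ)) := by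
          gcongr with x
          · exact hg x
          · split_ifs
            exacts [le_max_right _ _, le_max_left _ _]
      _ = ∑ x, g x * (∑ j ∈ insert i A, bsign (x j)) ^ 2 +
            ∑ x, g x * (max t0.depth t1.depth : ℕ) := by
          rw [← Finset.sum_add_distrib]
          exact Finset.sum_congr rfl fun x _ => mul_add _ _ _
      _ ≤ ∑ x, g x * ((∑ j ∈ A, bsign (x j)) ^ 2 + 1) +
            ∑ x, g x * (max t0.depth t1.depth : ℕ) := by
          gcongr ?_ + _
          exact sum_mul_sq_insert_le A i g hg hA
      _ = _ := by
          rw [← Finset.sum_add_distrib]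
          refine Finset.sum_congr rfl fun x _ => ?_
          simp only [depth]
          push_cast
          ring

end PDT

/-- **Remark.** For an ordinary decision tree `T` of depth `d` (every internal node
queries a single coordinate), `E_{ℓ∈T}[(∑ᵢ ℓᵢ)²] ≤ d`, where the leaf `ℓ` is
distributed according to the fraction of uniform inputs reaching it. -/
theorem ordinary_leaf_second_moment_le {n d : ℕ} (T : PDT n)
    (hord : T.Ordinary) (hd : T.depth ≤ d) :
    (∑ x : Fin n → Bool, (∑ i : Fin n, T.leafVec x i) ^ 2) / 2 ^ n ≤ d := by
  have h := hord.sum_mul_sq_union_queried_le ∅ (fun _ => 1) (fun _ => zero_le_one)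
    (fun _ _ _ => rfl)
  simp only [one_mul, Finset.empty_union, Finset.sum_empty, ne_eq, OfNat.ofNat_ne_zero,
    not_false_eq_true, zero_pow, zero_add, Finset.sum_const, Finset.card_univ,
    Fintype.card_fun, Fintype.card_bool, Fintype.card_fin, nsmul_eq_mul, Nat.cast_pow,
    Nat.cast_ofNat] at h
  have hsum (x : Fin n → Bool) :
      ∑ i, T.leafVec x i = ∑ i ∈ T.queried x, bsign (x i) := by
    simp [hord.leafVec_eq]
  simp only [hsum]
  rw [div_le_iff₀' (by positivity)]
  refine h.trans ?_
  gcongr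
end
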